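/- arXiv:2211.06057 — 2 statements merged into one kernel-verified Lean document; each statement's English description precedes it below -/
import Mathlib

section
/- Let ℂ₊ := {z ∈ ℂ : Im z > 0} be the upper half-plane and let V be a proper (V ≠ Hol(ℂ₊)) closed linear subspace of Hol(ℂ₊). Then V is invariant under all the composition operators f ↦ (z ↦ f(z + x)) for x ∈ ℝ and f ↦ (z ↦ f(λz)) for λ > 0 if and only if there exists k ∈ ℕ such that V = 𝒫^k, the space of restrictions to ℂ₊ of complex polynomials of degree < k (with 𝒫^0 = {0}). -/
noncomputable section

open Complex

/-- The upper half-plane `ℂ₊`. -/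
def CPos : Set ℂ := {z | 0 < z.im}

/-- Translation `z ↦ z + x` of the upper half-plane. -/
def transH (x : ℝ) (z : ↥CPos) : ↥CPos :=
  ⟨(z : ℂ) + (x : ℂ), by
    have hz : 0 < (z : ℂ).im := z.2
    show 0 < ((z : ℂ) + (x : ℂ)).im
    simpa using hz⟩

/-- Dilation `z ↦ λ z` of the upper half-plane, `λ > 0`. -/
def dilH (l : ℝ) (hl : 0 < l) (z : ↥CPos) : ↥CPos :=
  ⟨(l : ℂ) * (z : ℂ), by
    have hz : 0 < (z : ℂ).im := z.2
    show 0 < ((l : ℂ) * (z : ℂ)).im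
    simpa [Complex.mul_im] using mul_pos hl hz⟩

/-- A function on `ℂ₊` is holomorphic if it is the restriction of a function
holomorphic on `ℂ₊`. -/
def HoloOnH (f : ↥CPos → ℂ) : Prop :=
  ∃ F : ℂ → ℂ, DifferentiableOn ℂ F CPos ∧ ∀ z : ↥CPos, F ↑z = f z

/-- Membership in the closure of a set of functions on `ℂ₊` for the topology of
uniform convergence on compact subsets. -/
def MemClosureH (S : Set (↥CPos → ℂ)) (f : ↥CPos → ℂ) : Prop :=
  ∀ K : Set ↥CPos, IsCompact K → ∀ ε : ℝ, 0 < ε → ∃ g ∈ S, ∀ z ∈ K, ‖f z - g z‖ ≤ ε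

/-- `𝒫^k`: restrictions to `ℂ₊` of polynomials of degree `< k`. -/
def PolyLtH (k : ℕ) : Set (↥CPos → ℂ) :=
  {f | ∃ p : Polynomial ℂ, p.degree < (k : ℕ) ∧ ∀ z : ↥CPos, f z = p.eval ↑z}

open Metric

lemma isOpen_CPos : IsOpen CPos := isOpen_lt continuous_const Complex.continuous_im

lemma isPreconnected_CPos : IsPreconnected CPos :=
  (convex_halfSpace_im_gt 0).isPreconnected

/-- The `n`-th Taylor coefficient of `F` at `c`. -/
def taylorCoeffC (F : ℂ → ℂ) (n : ℕ) (c : ℂ) : ℂ := (n.factorial : ℂ)⁻¹ * iteratedDeriv n F c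

lemma norm_sub_taylor_le {F : ℂ → ℂ} {c w : ℂ} {R C : ℝ} (hR : 0 < R)
    {U : Set ℂ} (hF : DifferentiableOn ℂ F U) (hU : closedBall c R ⊆ U)
    (hC : ∀ z ∈ closedBall c R, ‖F z‖ ≤ C) (q : ℝ) (hq : q < 1) (hw : ‖w‖ ≤ q * R) (n : ℕ) :
    ‖F (c + w) - ∑ j ∈ Finset.range n, taylorCoeffC F j c * w ^ j‖
      ≤ C * (‖w‖ / R) ^ n / (1 - q) := by
  have hC0 : 0 ≤ C := (norm_nonneg _).trans (hC c (mem_closedBall_self hR.le))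
  have hr : ‖w‖ / R ≤ q := (div_le_iff₀ hR).2 hw
  have hwR : c + w ∈ ball c R := by
    rw [mem_ball, dist_eq_norm, add_sub_cancel_left]
    nlinarith
  have hs := Complex.hasSum_taylorSeries_on_ball
    (hF.mono (ball_subset_closedBall.trans hU)) hwR
  have hlim := hs.tendsto_sum_nat
  have hterm : ∀ j : ℕ, ((j.factorial : ℂ))⁻¹ • (c + w - c) ^ j • iteratedDeriv j F c
      = taylorCoeffC F j c * w ^ j := by
    intro j
    simp only [taylorCoeffC, add_sub_cancel_left, smul_eq_mul]
    ring
  simp only [hterm] at hlim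
  have hd : ∀ j : ℕ, dist (∑ i ∈ Finset.range j, taylorCoeffC F i c * w ^ i)
      (∑ i ∈ Finset.range (j + 1), taylorCoeffC F i c * w ^ i) ≤ C * (‖w‖ / R) ^ j := by
    intro j
    rw [Finset.sum_range_succ, dist_self_add_right, norm_mul, norm_pow, taylorCoeffC, norm_mul,
      norm_inv, Complex.norm_natCast]
    have h1 := Complex.norm_iteratedDeriv_le_of_forall_mem_sphere_norm_le j hR
      (hF.diffContOnCl_ball hU) (fun z hz => hC z (sphere_subset_closedBall hz))
    have h2 : (0 : ℝ) < j.factorial := by positivity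
    calc (j.factorial : ℝ)⁻¹ * ‖iteratedDeriv j F c‖ * ‖w‖ ^ j
        ≤ (j.factorial : ℝ)⁻¹ * (j.factorial * C / R ^ j) * ‖w‖ ^ j := by gcongr
      _ = C * (‖w‖ / R) ^ j := by
        rw [div_pow]
        field_simp
  have h := dist_le_of_le_geometric_of_tendsto (‖w‖ / R) C (hr.trans_lt hq) hd hlim n
  rw [dist_comm, dist_eq_norm] at h
  refine h.trans ?_
  gcongr

/-- Functions uniformly approximable on `K` by elements of `W`. -/
def unifClosureOn (W : Submodule ℂ (ℂ → ℂ)) (K : Set ℂ) : Submodule ℂ (ℂ → ℂ) where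
  carrier := {F | ∀ ε : ℝ, 0 < ε → ∃ G ∈ W, ∀ z ∈ K, ‖F z - G z‖ ≤ ε}
  zero_mem' := fun ε hε => ⟨0, W.zero_mem, fun z _ => by simpa using hε.le⟩
  add_mem' := by
    intro F₁ F₂ h₁ h₂ ε hε
    obtain ⟨G₁, hG₁, hK₁⟩ := h₁ (ε / 2) (by positivity)
    obtain ⟨G₂, hG₂, hK₂⟩ := h₂ (ε / 2) (by positivity)
    refine ⟨G₁ + G₂, W.add_mem hG₁ hG₂, fun z hz => ?_⟩
    have := norm_add_le (F₁ z - G₁ z) (F₂ z - G₂ z)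
    have h := hK₁ z hz
    have h' := hK₂ z hz
    rw [Pi.add_apply, Pi.add_apply, add_sub_add_comm]
    linarith
  smul_mem' := by
    intro c F h ε hε
    obtain ⟨G, hG, hK⟩ := h (ε / (‖c‖ + 1)) (by positivity)
    refine ⟨c • G, W.smul_mem c hG, fun z hz => ?_⟩
    have h := hK z hz
    rw [Pi.smul_apply, Pi.smul_apply, ← smul_sub, norm_smul]
    calc ‖c‖ * ‖F z - G z‖ ≤ (‖c‖ + 1) * (ε / (‖c‖ + 1)) := by gcongr; linarith
      _ = ε := by field_simp

lemma le_unifClosureOn (W : Submodule ℂ (ℂ → ℂ)) (K : Set ℂ) : W ≤ unifClosureOn W K :=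
  fun F hF ε hε => ⟨F, hF, fun z _ => by simpa using hε.le⟩

lemma mem_unifClosureOn_of_forall {W : Submodule ℂ (ℂ → ℂ)} {K : Set ℂ} {F : ℂ → ℂ}
    (h : ∀ ε : ℝ, 0 < ε → ∃ G ∈ unifClosureOn W K, ∀ z ∈ K, ‖F z - G z‖ ≤ ε) :
    F ∈ unifClosureOn W K := by
  intro ε hε
  obtain ⟨G, hG, hK⟩ := h (ε / 2) (by positivity)
  obtain ⟨H, hH, hK'⟩ := hG (ε / 2) (by positivity)
  refine ⟨H, hH, fun z hz => ?_⟩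
  have h₁ := hK z hz
  have h₂ := hK' z hz
  have := norm_sub_le_norm_sub_add_norm_sub (F z) (G z) (H z)
  linarith

/-- Closed affinely invariant spaces of holomorphic functions on `ℂ₊`, the functions being
represented by arbitrary extensions to `ℂ`. -/
structure IsAffineInvariant (W : Submodule ℂ (ℂ → ℂ)) : Prop where
  holo : ∀ F ∈ W, DifferentiableOn ℂ F CPos
  closed : ∀ F : ℂ → ℂ, DifferentiableOn ℂ F CPos →
    (∀ K ⊆ CPos, IsCompact K → F ∈ unifClosureOn W K) → F ∈ W
  trans : ∀ F ∈ W, ∀ x : ℝ, (fun z => F (z + x)) ∈ W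
  dil : ∀ F ∈ W, ∀ l : ℝ, 0 < l → (fun z => F (l * z)) ∈ W

lemma exists_radius_bound {K : Set ℂ} (hK : IsCompact K) (hKs : K ⊆ CPos) :
    ∃ δ : ℝ, 0 < δ ∧ (∀ z ∈ K, closedBall z δ ⊆ CPos) ∧
      ∀ F : ℂ → ℂ, ContinuousOn F CPos → ∃ C : ℝ, ∀ z ∈ K, ∀ u ∈ closedBall z δ, ‖F u‖ ≤ C := by
  obtain ⟨δ, hδ, hsub⟩ := hK.exists_cthickening_subset_open isOpen_CPos hKs
  refine ⟨δ, hδ, fun z hz => (closedBall_subset_cthickening hz δ).trans hsub, fun F hF => ?_⟩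
  obtain ⟨C, hC⟩ := (hK.cthickening (r := δ)).exists_bound_of_continuousOn (hF.mono hsub)
  exact ⟨C, fun z hz u hu => hC u (closedBall_subset_cthickening hz δ hu)⟩

/-- The polynomial `∑_{j<n} a_j (X - c)^j` with `a_j` the Taylor coefficients of `F` at `c`. -/
def taylorPolyC (F : ℂ → ℂ) (n : ℕ) (c : ℂ) : Polynomial ℂ :=
  ∑ j ∈ Finset.range n, Polynomial.C (taylorCoeffC F j c) * (Polynomial.X - Polynomial.C c) ^ j

lemma taylorPolyC_eval (F : ℂ → ℂ) (n : ℕ) (c z : ℂ) :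
    (taylorPolyC F n c).eval z = ∑ j ∈ Finset.range n, taylorCoeffC F j c * (z - c) ^ j := by
  simp [taylorPolyC, Polynomial.eval_finsetSum]

lemma taylorPolyC_degree_lt (F : ℂ → ℂ) (n : ℕ) (c : ℂ) :
    (taylorPolyC F n c).degree < n := by
  rw [← Polynomial.mem_degreeLT]
  refine Submodule.sum_mem _ fun j hj => ?_
  rw [Polynomial.mem_degreeLT]
  refine (Polynomial.degree_mul_le _ _).trans_lt ((add_le_add_left Polynomial.degree_C_le _).trans_lt ?_)
  rw [zero_add, Polynomial.degree_pow, Polynomial.degree_X_sub_C, nsmul_eq_mul, mul_one]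
  exact_mod_cast Finset.mem_range.1 hj

lemma exists_closedBall_superset {K : Set ℂ} (hK : IsCompact K) (hKs : K ⊆ CPos) :
    ∃ (c : ℂ) (q R : ℝ), q < 1 ∧ 0 < R ∧ closedBall c R ⊆ CPos ∧
      ∀ z ∈ K, ‖z - c‖ ≤ q * R := by
  obtain ⟨B, hB⟩ := hK.exists_bound_of_continuousOn (f := fun z : ℂ => z) continuousOn_id
  obtain ⟨δ, hδ, hball, -⟩ := exists_radius_bound hK hKs
  have him : ∀ z ∈ K, δ < z.im := by
    intro z hz
    have h : z - δ * I ∈ CPos := hball z hz (by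
      simp [mem_closedBall, abs_of_pos hδ])
    have h' : 0 < (z - δ * I).im := h
    simp at h'
    linarith
  set D : ℝ := |B| + 1
  have hD : 0 < D := by positivity
  set M : ℝ := D ^ 2 / δ + δ + 1
  have hM : 0 < M := by positivity
  have hDM : D ^ 2 / δ + δ ≤ M := by simp [M]
  have hMδ : δ < M := by
    have : 0 < D ^ 2 / δ := by positivity
    linarith
  have hD2 : D ^ 2 ≤ δ * (M - δ) := by
    have : D ^ 2 / δ ≤ M - δ := by linarith
    rw [div_le_iff₀ hδ] at this
    linarith
  refine ⟨M * I, (M - δ / 2) / (M - δ / 4), M - δ / 4, ?_, by linarith, ?_, ?_⟩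
  · rw [div_lt_one (by linarith)]
    linarith
  · intro z hz
    rw [mem_closedBall, dist_eq_norm] at hz
    have h := (abs_le.1 ((Complex.abs_im_le_norm _).trans hz)).1
    show 0 < z.im
    simp at h
    linarith
  · intro z hz
    rw [div_mul_cancel₀ _ (by linarith : M - δ / 4 ≠ 0)]
    have h1 := him z hz
    have h2 : ‖z‖ ≤ D := (hB z hz).trans ((le_abs_self B).trans (by simp [D]))
    have h3 : z.re ^ 2 + z.im ^ 2 ≤ D ^ 2 := by
      have := Complex.sq_norm z
      rw [Complex.normSq_apply] at this
      have h4 : ‖z‖ ^ 2 ≤ D ^ 2 := by gcongr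
      nlinarith
    refine le_of_sq_le_sq ?_ (by linarith)
    rw [Complex.sq_norm, Complex.normSq_apply]
    simp
    nlinarith

lemma eqOn_taylorPolyC {F : ℂ → ℂ} (hF : DifferentiableOn ℂ F CPos) {c : ℂ}
    (hc : c ∈ CPos) {k : ℕ} (h : ∀ n, k ≤ n → taylorCoeffC F n c = 0) :
    Set.EqOn F (fun z => (taylorPolyC F k c).eval z) CPos := by
  obtain ⟨R, hR, hball⟩ := Metric.isOpen_iff.1 isOpen_CPos c hc
  refine AnalyticOnNhd.eqOn_of_preconnected_of_eventuallyEq (hF.analyticOnNhd isOpen_CPos)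
    (DifferentiableOn.analyticOnNhd (Polynomial.differentiable _).differentiableOn isOpen_CPos)
    isPreconnected_CPos hc ?_
  filter_upwards [Metric.ball_mem_nhds c hR] with z hz
  have h1 := Complex.hasSum_taylorSeries_on_ball (hF.mono hball) hz
  refine h1.unique ?_
  rw [taylorPolyC_eval]
  have h2 : (fun j : ℕ => (j.factorial : ℂ)⁻¹ • (z - c) ^ j • iteratedDeriv j F c) =
      fun j => taylorCoeffC F j c * (z - c) ^ j := by
    ext j
    simp only [taylorCoeffC, smul_eq_mul]
    ring
  rw [h2]
  exact hasSum_sum_of_ne_finset_zero fun j hj => by rw [h j (by simpa using hj), zero_mul]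

namespace IsAffineInvariant

variable {W : Submodule ℂ (ℂ → ℂ)}

lemma deriv_mem (hW : IsAffineInvariant W) {F : ℂ → ℂ} (hF : F ∈ W) : deriv F ∈ W := by
  refine hW.closed _ ((hW.holo F hF).deriv isOpen_CPos) fun K hKs hK => ?_
  obtain ⟨δ, hδ, hball, hbd⟩ := exists_radius_bound hK hKs
  obtain ⟨C, hC⟩ := hbd F (hW.holo F hF).continuousOn
  intro ε hε
  obtain ⟨h, hh0, hh1, hh2⟩ : ∃ h : ℝ, 0 < h ∧ h ≤ 1 / 2 * δ ∧ 2 * |C| / δ ^ 2 * h ≤ ε := by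
    refine ⟨min (1 / 2 * δ) (ε / (2 * |C| / δ ^ 2 + 1)), by positivity, min_le_left _ _, ?_⟩
    calc 2 * |C| / δ ^ 2 * min (1 / 2 * δ) (ε / (2 * |C| / δ ^ 2 + 1))
        ≤ (2 * |C| / δ ^ 2 + 1) * (ε / (2 * |C| / δ ^ 2 + 1)) := by
          gcongr
          · linarith
          · exact min_le_right _ _
      _ = ε := by field_simp
  refine ⟨(h : ℂ)⁻¹ • ((fun z => F (z + h)) - F),
    W.smul_mem _ (W.sub_mem (hW.trans F hF h) hF), fun z hz => ?_⟩
  have hn : ‖(h : ℂ)‖ = h := by rw [Complex.norm_real, Real.norm_of_nonneg hh0.le]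
  have key := norm_sub_taylor_le hδ (hW.holo F hF) (hball z hz)
    (fun u hu => (hC z hz u hu).trans (le_abs_self C)) (1 / 2) (by norm_num) (hn.trans_le hh1) 2
  have hhc : (h : ℂ) ≠ 0 := by exact_mod_cast hh0.ne'
  have e : deriv F z - ((h : ℂ)⁻¹ • ((fun z => F (z + h)) - F)) z =
      -((h : ℂ)⁻¹ * (F (z + h) - ∑ j ∈ Finset.range 2, taylorCoeffC F j z * (h : ℂ) ^ j)) := by
    simp only [Finset.sum_range_succ, Finset.sum_range_zero, taylorCoeffC, iteratedDeriv_zero,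
      iteratedDeriv_one, Pi.smul_apply, Pi.sub_apply, smul_eq_mul, Nat.factorial]
    field_simp
    push_cast
    ring
  rw [e, norm_neg, norm_mul, norm_inv, hn]
  rw [hn] at key
  calc h⁻¹ * _ ≤ h⁻¹ * (|C| * (h / δ) ^ 2 / (1 - 1 / 2)) := by gcongr
    _ = 2 * |C| / δ ^ 2 * h := by field_simp; norm_num
    _ ≤ ε := hh2

lemma iteratedDeriv_mem (hW : IsAffineInvariant W) {F : ℂ → ℂ} (hF : F ∈ W) (n : ℕ) :
    iteratedDeriv n F ∈ W := by
  induction n with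
  | zero => simpa using hF
  | succ n ih => rw [iteratedDeriv_succ]; exact hW.deriv_mem ih

lemma translate_step (hW : IsAffineInvariant W) {K : Set ℂ} (hK : IsCompact K) (hKs : K ⊆ CPos) :
    ∃ δ : ℝ, 0 < δ ∧ ∀ h : ℝ, 0 ≤ h → h ≤ δ → ∀ y : ℝ, 0 ≤ y →
      (∀ F ∈ W, (fun z => F (z + y * I)) ∈ unifClosureOn W K) →
      ∀ F ∈ W, (fun z => F (z + (y + h : ℝ) * I)) ∈ unifClosureOn W K := by
  obtain ⟨δ, hδ, hball, hbd⟩ := exists_radius_bound hK hKs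
  refine ⟨1 / 2 * δ, by positivity, fun h h0 hhδ y hy hP F hF => ?_⟩
  have hmem : ∀ z ∈ CPos, z + y * I ∈ CPos := by
    intro z hz
    have hz' : 0 < z.im := hz
    show 0 < (z + y * I).im
    simp only [add_im, mul_im, ofReal_re, I_im, ofReal_im, I_re]
    linarith
  have hdF : DifferentiableOn ℂ (fun z => F (z + y * I)) CPos :=
    (hW.holo F hF).comp (by fun_prop) hmem
  obtain ⟨C, hC⟩ := hbd _ hdF.continuousOn
  have hn : ‖(h : ℂ) * I‖ = h := by
    rw [norm_mul, Complex.norm_I, mul_one, Complex.norm_real, Real.norm_of_nonneg h0]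
  refine mem_unifClosureOn_of_forall fun ε hε => ?_
  obtain ⟨n, hnε⟩ : ∃ n : ℕ, 2 * |C| * (1 / 2) ^ n ≤ ε := by
    obtain ⟨n, hn⟩ := exists_pow_lt_of_lt_one (show 0 < ε / (2 * |C| + 1) by positivity)
      (show (1 / 2 : ℝ) < 1 by norm_num)
    refine ⟨n, ?_⟩
    calc 2 * |C| * (1 / 2 : ℝ) ^ n ≤ (2 * |C| + 1) * (ε / (2 * |C| + 1)) := by
          gcongr
          linarith
      _ = ε := by field_simp
  refine ⟨∑ j ∈ Finset.range n, (((j.factorial : ℂ))⁻¹ * (h * I) ^ j) •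
    fun z => iteratedDeriv j F (z + y * I), Submodule.sum_mem _ fun j _ =>
      Submodule.smul_mem _ _ (hP _ (hW.iteratedDeriv_mem hF j)), fun z hz => ?_⟩
  have key := norm_sub_taylor_le hδ hdF (hball z hz)
    (fun u hu => (hC z hz u hu).trans (le_abs_self C)) (1 / 2) (by norm_num) (hn.trans_le hhδ) n
  rw [hn] at key
  have e : F (z + (y + h : ℝ) * I) - (∑ j ∈ Finset.range n, (((j.factorial : ℂ))⁻¹ * (h * I) ^ j) •
      fun z => iteratedDeriv j F (z + y * I)) z = F (z + h * I + y * I) -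
      ∑ j ∈ Finset.range n, taylorCoeffC (fun z => F (z + y * I)) j z * (h * I) ^ j := by
    congr 1
    · congr 1
      push_cast
      ring
    · rw [Finset.sum_apply]
      refine Finset.sum_congr rfl fun j _ => ?_
      rw [taylorCoeffC, iteratedDeriv_comp_add_const, Pi.smul_apply, smul_eq_mul]
      ring
  rw [e]
  refine key.trans (le_trans ?_ hnε)
  have : h / δ ≤ 1 / 2 := (div_le_iff₀ hδ).2 hhδ
  calc |C| * (h / δ) ^ n / (1 - 1 / 2) = 2 * |C| * (h / δ) ^ n := by ring
    _ ≤ 2 * |C| * (1 / 2) ^ n := by gcongr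

lemma translate_I_mem (hW : IsAffineInvariant W) {F : ℂ → ℂ} (hF : F ∈ W) :
    (fun z => F (z + I)) ∈ W := by
  refine hW.closed _ ?_ fun K hKs hK => ?_
  · refine (hW.holo F hF).comp (by fun_prop) fun z hz => ?_
    have hz' : 0 < z.im := hz
    show 0 < (z + I).im
    simp only [add_im, I_im]
    linarith
  obtain ⟨δ, hδ, hstep⟩ := hW.translate_step hK hKs
  obtain ⟨N, hN⟩ := exists_nat_gt (1 / δ)
  have hN0 : (0 : ℝ) < N := lt_trans (by positivity) hN
  have hNδ : 1 / (N : ℝ) ≤ δ := by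
    rw [div_le_iff₀ hN0]
    rw [div_lt_iff₀ hδ] at hN
    linarith
  have hind : ∀ m : ℕ, ∀ F ∈ W, (fun z => F (z + (m / N : ℝ) * I)) ∈ unifClosureOn W K := by
    intro m
    induction m with
    | zero =>
      intro F hF
      simpa using le_unifClosureOn W K hF
    | succ m ih =>
      intro F hF
      have := hstep (1 / N) (by positivity) hNδ (m / N) (by positivity) ih F hF
      convert this using 5
      push_cast
      ring
  have := hind N F hF
  rwa [div_self hN0.ne', ofReal_one, one_mul] at this

lemma taylorCoeff_smul_pow_mem (hW : IsAffineInvariant W) {F : ℂ → ℂ} (hF : F ∈ W) (n : ℕ) :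
    (fun z => taylorCoeffC F n I * z ^ n) ∈ W := by
  induction n using Nat.strong_induction_on with
  | _ n ih =>
  refine hW.closed _ (by fun_prop) fun K hKs hK => ?_
  obtain ⟨B, hB0, hB⟩ : ∃ B : ℝ, 0 < B ∧ ∀ z ∈ K, ‖z‖ ≤ B := by
    obtain ⟨B, hB⟩ := hK.exists_bound_of_continuousOn (f := fun z : ℂ => z) continuousOn_id
    exact ⟨|B| + 1, by positivity, fun z hz =>
      (hB z hz).trans ((le_abs_self B).trans (by linarith))⟩
  obtain ⟨δ, hδ, hball, hbd⟩ := exists_radius_bound (K := {I}) isCompact_singleton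
    (by rintro _ rfl; show 0 < I.im; simp)
  obtain ⟨C, hC⟩ := hbd F (hW.holo F hF).continuousOn
  intro ε hε
  set M : ℝ := 2 * |C| * (B / δ) ^ (n + 1) with hM
  have hM0 : 0 ≤ M := by positivity
  obtain ⟨a, ha0, ha1, ha2⟩ : ∃ a : ℝ, 0 < a ∧ a * B ≤ 1 / 2 * δ ∧ M * a ≤ ε := by
    refine ⟨min (1 / 2 * δ / B) (ε / (M + 1)), by positivity, ?_, ?_⟩
    · rw [← le_div_iff₀ hB0]
      exact min_le_left _ _
    · calc M * min (1 / 2 * δ / B) (ε / (M + 1)) ≤ (M + 1) * (ε / (M + 1)) := by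
            gcongr
            · linarith
            · exact min_le_right _ _
        _ = ε := by field_simp
  have hac : (a : ℂ) ≠ 0 := by exact_mod_cast ha0.ne'
  refine ⟨((a : ℂ) ^ n)⁻¹ • ((fun z => F (a * z + I)) -
    ∑ j ∈ Finset.range n, ((a : ℂ) ^ j) • fun z => taylorCoeffC F j I * z ^ j), ?_, fun z hz => ?_⟩
  · refine W.smul_mem _ (W.sub_mem (hW.dil _ (hW.translate_I_mem hF) a ha0) ?_)
    exact W.sum_mem fun j hj => W.smul_mem _ (ih j (Finset.mem_range.1 hj))
  have hn : ‖(a : ℂ) * z‖ ≤ a * B := by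
    rw [norm_mul, Complex.norm_real, Real.norm_of_nonneg ha0.le]
    gcongr
    exact hB z hz
  have key := norm_sub_taylor_le hδ (hW.holo F hF) (hball I rfl)
    (fun u hu => (hC I rfl u hu).trans (le_abs_self C)) (1 / 2) (by norm_num) (hn.trans ha1) (n + 1)
  have e : taylorCoeffC F n I * z ^ n - (((a : ℂ) ^ n)⁻¹ • ((fun z => F (a * z + I)) -
      ∑ j ∈ Finset.range n, ((a : ℂ) ^ j) • fun z => taylorCoeffC F j I * z ^ j)) z =
      -(((a : ℂ) ^ n)⁻¹ * (F (I + a * z) -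
        ∑ j ∈ Finset.range (n + 1), taylorCoeffC F j I * (a * z) ^ j)) := by
    have e₁ : ∑ j ∈ Finset.range n, taylorCoeffC F j I * (a * z) ^ j =
        (∑ j ∈ Finset.range n, ((a : ℂ) ^ j) • fun z => taylorCoeffC F j I * z ^ j) z := by
      rw [Finset.sum_apply]
      refine Finset.sum_congr rfl fun j _ => ?_
      simp only [Pi.smul_apply, smul_eq_mul]
      ring
    rw [Finset.sum_range_succ, e₁, Pi.smul_apply, Pi.sub_apply, smul_eq_mul, add_comm I]
    field_simp
    ring
  rw [e, norm_neg, norm_mul, norm_inv, norm_pow, Complex.norm_real, Real.norm_of_nonneg ha0.le]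
  calc (a ^ n)⁻¹ * _ ≤ (a ^ n)⁻¹ * (|C| * (a * B / δ) ^ (n + 1) / (1 - 1 / 2)) := by
        gcongr
        refine key.trans ?_
        gcongr
    _ = M * a := by
        rw [hM, div_pow, div_pow, mul_pow]
        field_simp
        ring
    _ ≤ ε := ha2

lemma pow_mem_of_succ (hW : IsAffineInvariant W) {n : ℕ} (h : (fun z : ℂ => z ^ (n + 1)) ∈ W) :
    (fun z : ℂ => z ^ n) ∈ W := by
  have h' := W.smul_mem ((n + 1 : ℂ)⁻¹) (hW.deriv_mem h)
  convert h' using 1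
  ext z
  have : (n + 1 : ℂ) ≠ 0 := by exact_mod_cast Nat.succ_ne_zero n
  simp only [Pi.smul_apply, smul_eq_mul, deriv_pow_field, Nat.cast_add, Nat.cast_one,
    Nat.add_sub_cancel]
  field_simp

lemma pow_mem_of_le (hW : IsAffineInvariant W) {m n : ℕ} (hmn : m ≤ n)
    (h : (fun z : ℂ => z ^ n) ∈ W) : (fun z : ℂ => z ^ m) ∈ W := by
  induction n, hmn using Nat.le_induction with
  | base => exact h
  | succ n _ ih => exact ih (hW.pow_mem_of_succ h)

lemma polynomial_eval_mem {k : ℕ} (h : ∀ n < k, (fun z : ℂ => z ^ n) ∈ W) {p : Polynomial ℂ}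
    (hp : p.degree < k) : (fun z => p.eval z) ∈ W := by
  have e : (fun z => p.eval z) =
      ∑ i ∈ Finset.range p.natDegree.succ, p.coeff i • fun z : ℂ => z ^ i := by
    ext z
    rw [Polynomial.eval_eq_sum_range, Finset.sum_apply]
    rfl
  rw [e]
  refine W.sum_mem fun i _ => ?_
  by_cases hi : i < k
  · exact W.smul_mem _ (h i hi)
  · rw [(Polynomial.degree_lt_iff_coeff_zero p k).1 hp i (not_lt.1 hi), zero_smul]
    exact W.zero_mem

/-- A closed affinely invariant space containing all monomials is everything. -/
lemma mem_of_forall_pow_mem (hW : IsAffineInvariant W) (h : ∀ n : ℕ, (fun z : ℂ => z ^ n) ∈ W)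
    {F : ℂ → ℂ} (hF : DifferentiableOn ℂ F CPos) : F ∈ W := by
  refine hW.closed F hF fun K hKs hK ε hε => ?_
  obtain ⟨c, q, R, hq, hR, hball, hKc⟩ := exists_closedBall_superset hK hKs
  obtain ⟨C, hC⟩ := (isCompact_closedBall c R).exists_bound_of_continuousOn
    (hF.continuousOn.mono hball)
  have hC0 : 0 ≤ C := (norm_nonneg _).trans (hC c (mem_closedBall_self hR.le))
  have hq1 : 0 < 1 - q := by linarith
  obtain ⟨n, hn⟩ := exists_pow_lt_of_lt_one
    (show 0 < ε * (1 - q) / (C + 1) by positivity) hq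
  refine ⟨fun z => (taylorPolyC F n c).eval z,
    polynomial_eval_mem (fun m _ => h m) (taylorPolyC_degree_lt F n c), fun z hz => ?_⟩
  have key := norm_sub_taylor_le hR hF hball hC q hq (hKc z hz) n
  rw [add_sub_cancel] at key
  simp only [taylorPolyC_eval]
  have h1 : ‖z - c‖ / R ≤ q := (div_le_iff₀ hR).2 (hKc z hz)
  calc _ ≤ C * (‖z - c‖ / R) ^ n / (1 - q) := key
    _ ≤ (C + 1) * (ε * (1 - q) / (C + 1)) / (1 - q) := by
      gcongr
      · linarith
      · exact (pow_le_pow_left₀ (by positivity) h1 n).trans hn.le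
    _ = ε := by field_simp

lemma exists_eq_polynomial (hW : IsAffineInvariant W)
    (hproper : ∃ F, DifferentiableOn ℂ F CPos ∧ F ∉ W) :
    ∃ k : ℕ, (∀ p : Polynomial ℂ, p.degree < k → (fun z => p.eval z) ∈ W) ∧
      ∀ F ∈ W, ∃ p : Polynomial ℂ, p.degree < k ∧ Set.EqOn F (fun z => p.eval z) CPos := by
  classical
  have hex : ∃ n : ℕ, (fun z : ℂ => z ^ n) ∉ W := by
    by_contra! hall
    obtain ⟨F, hF, hFW⟩ := hproper
    exact hFW (hW.mem_of_forall_pow_mem hall hF)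
  refine ⟨Nat.find hex, fun p hp => polynomial_eval_mem
    (fun n hn => not_not.1 (Nat.find_min hex hn)) hp, fun F hF => ?_⟩
  refine ⟨taylorPolyC F (Nat.find hex) I, taylorPolyC_degree_lt _ _ _,
    eqOn_taylorPolyC (hW.holo F hF) (by show 0 < I.im; simp) fun n hn => ?_⟩
  by_contra hne
  refine Nat.find_spec hex (hW.pow_mem_of_le hn ?_)
  convert W.smul_mem (taylorCoeffC F n I)⁻¹ (hW.taylorCoeff_smul_pow_mem hF n) using 1
  ext z
  simp [hne]

end IsAffineInvariant

lemma HoloOnH_restrict {F : ℂ → ℂ} (hF : DifferentiableOn ℂ F CPos) :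
    HoloOnH (fun z => F z) := ⟨F, hF, fun _ => rfl⟩

lemma PolyLtH_comp {k : ℕ} {f : ↥CPos → ℂ} (hf : f ∈ PolyLtH k) {q : Polynomial ℂ}
    (hq : q.degree ≤ 1) {φ : ↥CPos → ↥CPos} (hφ : ∀ z, (φ z : ℂ) = q.eval ↑z) :
    (fun z => f (φ z)) ∈ PolyLtH k := by
  obtain ⟨p, hp, hpf⟩ := hf
  refine ⟨p.comp q, ?_, fun z => by simp only [hpf, hφ, Polynomial.eval_comp]⟩
  by_cases h0 : p = 0
  · rw [h0, Polynomial.zero_comp]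
    rwa [h0] at hp
  · rw [← Polynomial.natDegree_lt_iff_degree_lt h0] at hp
    refine Polynomial.degree_le_natDegree.trans_lt ?_
    have h1 : (p.comp q).natDegree ≤ p.natDegree * 1 :=
      Polynomial.natDegree_comp_le.trans
        (Nat.mul_le_mul_left _ (Polynomial.natDegree_le_of_degree_le hq))
    exact_mod_cast (by omega : (p.comp q).natDegree < k)

/-- the proper closed subspaces of `Hol(ℂ₊)` invariant under the
affine automorphisms of `ℂ₊` are exactly the spaces of polynomials of degree
`< k`. -/
theorem stmt_2 (V : Set (↥CPos → ℂ))
    (hVholo : ∀ f ∈ V, HoloOnH f)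
    (hV0 : (0 : ↥CPos → ℂ) ∈ V)
    (hVadd : ∀ f ∈ V, ∀ g ∈ V, f + g ∈ V)
    (hVsmul : ∀ (c : ℂ), ∀ f ∈ V, c • f ∈ V)
    (hVclosed : ∀ f, HoloOnH f → MemClosureH V f → f ∈ V)
    (hVproper : ∃ f, HoloOnH f ∧ f ∉ V) :
    ((∀ f ∈ V, ∀ x : ℝ, (fun z => f (transH x z)) ∈ V) ∧
      (∀ f ∈ V, ∀ (l : ℝ) (hl : 0 < l), (fun z => f (dilH l hl z)) ∈ V)) ↔
      ∃ k : ℕ, V = PolyLtH k := by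
  constructor
  · rintro ⟨htrans, hdil⟩
    let W : Submodule ℂ (ℂ → ℂ) :=
      { carrier := {F | (fun z : ↥CPos => F z) ∈ V}
        zero_mem' := hV0
        add_mem' := fun {F G} hF hG => hVadd _ hF _ hG
        smul_mem' := fun c F hF => hVsmul c _ hF }
    have hWmem : ∀ F : ℂ → ℂ, F ∈ W ↔ (fun z : ↥CPos => F z) ∈ V := fun F => Iff.rfl
    have hext : ∀ f ∈ V, ∃ F ∈ W, DifferentiableOn ℂ F CPos ∧ ∀ z : ↥CPos, F z = f z := by
      intro f hf
      obtain ⟨F, hF, hFf⟩ := hVholo f hf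
      exact ⟨F, by rw [hWmem, funext hFf]; exact hf, hF, hFf⟩
    have hW : IsAffineInvariant W :=
      { holo := by
          intro F hF
          obtain ⟨G, -, hG, hGF⟩ := hext _ hF
          exact hG.congr fun z hz => (hGF ⟨z, hz⟩).symm
        closed := by
          intro F hF hcl
          refine hVclosed _ (HoloOnH_restrict hF) fun K hK ε hε => ?_
          obtain ⟨G, hG, hGK⟩ := hcl (Subtype.val '' K) (Subtype.coe_image_subset _ _)
            (hK.image continuous_subtype_val) ε hε
          exact ⟨_, hG, fun z hz => hGK z ⟨z, hz, rfl⟩⟩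
        trans := fun F hF x => htrans _ hF x
        dil := fun F hF l hl => hdil _ hF l hl }
    obtain ⟨k, hk₁, hk₂⟩ := hW.exists_eq_polynomial (by
      obtain ⟨f, ⟨F, hF, hFf⟩, hf⟩ := hVproper
      exact ⟨F, hF, by rw [hWmem, funext hFf]; exact hf⟩)
    refine ⟨k, Set.ext fun f => ⟨fun hf => ?_, ?_⟩⟩
    · obtain ⟨F, hFW, -, hFf⟩ := hext f hf
      obtain ⟨p, hp, hFp⟩ := hk₂ F hFW
      exact ⟨p, hp, fun z => by rw [← hFf z, hFp z.2]⟩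
    · rintro ⟨p, hp, hfp⟩
      rw [funext hfp]
      exact hk₁ p hp
  · rintro ⟨k, rfl⟩
    refine ⟨fun f hf x => PolyLtH_comp hf (q := Polynomial.X + Polynomial.C (x : ℂ)) ?_ ?_,
      fun f hf l hl => PolyLtH_comp hf (q := Polynomial.C (l : ℂ) * Polynomial.X) ?_ ?_⟩
    · exact (Polynomial.degree_X_add_C _).le
    · intro z
      simp [transH]
    · exact Polynomial.degree_C_mul_X_le _
    · intro z
      simp [dilH]
end
end

section
/- Let n ∈ ℕ and let B_{n+1} be the open unit ball of ℂ^{n+1}. For a holomorphic function f : B_{n+1} → ℂ, the following are equivalent: (i) the linear span of the functions w ↦ f(αw), as α ranges over the complex numbers with |α| = 1, is a finite-dimensional subspace of the space of functions on B_{n+1}; (ii) f is the restriction to B_{n+1} of a polynomial function on ℂ^{n+1}. -/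
noncomputable section

open Complex

/-- The open unit ball of `ℂ^{n+1}`. -/
def ballB (n : ℕ) : Set (EuclideanSpace ℂ (Fin (n + 1))) :=
  Metric.ball 0 1

/-- Rotation of the unit ball by a unimodular complex number. -/
def rotB (n : ℕ) (α : ℂ) (hα : ‖α‖ = 1) (w : ↥(ballB n)) : ↥(ballB n) :=
  ⟨α • (w : EuclideanSpace ℂ (Fin (n + 1))), by
    have hw := mem_ball_zero_iff.mp w.2
    show _ ∈ Metric.ball _ _
    rw [mem_ball_zero_iff, norm_smul, hα, one_mul]
    exact hw⟩

/-- A function on the unit ball is holomorphic if it is the restriction of a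
function holomorphic on the ball. -/
def HoloOnB (n : ℕ) (f : ↥(ballB n) → ℂ) : Prop :=
  ∃ F : EuclideanSpace ℂ (Fin (n + 1)) → ℂ,
    DifferentiableOn ℂ F (ballB n) ∧ ∀ w : ↥(ballB n), F ↑w = f w

theorem Polynomial.exists_norm_eval_le (p : Polynomial ℂ) {N : ℕ} (hp : p.natDegree ≤ N) :
    ∃ C, 0 ≤ C ∧ ∀ z, ‖p.eval z‖ ≤ C * (1 + ‖z‖) ^ N := by
  refine ⟨∑ i ∈ Finset.range (N + 1), ‖p.coeff i‖, by positivity, fun z => ?_⟩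
  rw [Polynomial.eval_eq_sum_range' (Nat.lt_succ_of_le hp), Finset.sum_mul]
  refine (norm_sum_le _ _).trans (Finset.sum_le_sum fun i hi => ?_)
  rw [norm_mul, norm_pow]
  have hz := norm_nonneg z
  have h1 : ‖z‖ ^ i ≤ (1 + ‖z‖) ^ i := by gcongr; linarith
  have h2 : (1 + ‖z‖) ^ i ≤ (1 + ‖z‖) ^ N :=
    pow_le_pow_right₀ (by linarith) (by simpa [Nat.lt_succ_iff] using hi)
  exact mul_le_mul_of_nonneg_left (h1.trans h2) (norm_nonneg _)

theorem Polynomial.natDegree_sum_range_C_mul_X_pow_le {R : Type*} [Semiring R] (a : ℕ → R) (N : ℕ) :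
    (∑ i ∈ Finset.range (N + 1), Polynomial.C (a i) * Polynomial.X ^ i).natDegree ≤ N :=
  Polynomial.natDegree_sum_le_of_forall_le _ _ fun _ hi =>
    (Polynomial.natDegree_C_mul_X_pow_le _ _).trans (Nat.lt_succ_iff.mp (Finset.mem_range.mp hi))

theorem Polynomial.degree_lt_card_range_of_natDegree_le {R : Type*} [Semiring R] {p : Polynomial R}
    {N : ℕ} (hp : p.natDegree ≤ N) : p.degree < (Finset.range (N + 1)).card :=
  (Polynomial.degree_le_of_natDegree_le hp).trans_lt
    (by simp only [Finset.card_range]; norm_cast; simp)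

theorem exists_polynomial_eq_of_norm_le_pow {g : ℂ → ℂ} (hg : Differentiable ℂ g) {C : ℝ} {N : ℕ}
    (hC : ∀ z, ‖g z‖ ≤ C * (1 + ‖z‖) ^ N) :
    ∃ q : Polynomial ℂ, q.natDegree ≤ N ∧ ∀ z, g z = q.eval z := by
  have hC0 : 0 ≤ C := by simpa using (norm_nonneg _).trans (hC 0)
  have hk : ∀ k, N < k → iteratedDeriv k g 0 = 0 := by
    intro k hk
    have hb : ∀ R : ℝ, 1 ≤ R → ‖iteratedDeriv k g 0‖ ≤ k.factorial * (C * 2 ^ N) / R := by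
      intro R hR
      have hR0 : 0 < R := by linarith
      refine (Complex.norm_iteratedDeriv_le_of_forall_mem_sphere_norm_le k hR0
        hg.diffContOnCl (C := C * (2 * R) ^ N) fun z hz => (hC z).trans ?_).trans ?_
      · have : ‖z‖ = R := by simpa using hz
        rw [this]
        gcongr
        linarith
      · rw [div_le_div_iff₀ (by positivity) hR0, mul_pow]
        have : R ^ N * R ≤ R ^ k := by
          rw [← pow_succ]; exact pow_le_pow_right₀ hR hk
        calc k.factorial * (C * (2 ^ N * R ^ N)) * R
            = k.factorial * (C * 2 ^ N) * (R ^ N * R) := by ring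
          _ ≤ _ := by gcongr
    have ht : Filter.Tendsto (fun R : ℝ => k.factorial * (C * 2 ^ N) / R) Filter.atTop (nhds 0) :=
      Filter.Tendsto.div_atTop tendsto_const_nhds Filter.tendsto_id
    refine norm_le_zero_iff.mp (ge_of_tendsto ht ?_)
    filter_upwards [Filter.eventually_ge_atTop 1] with R hR using hb R hR
  refine ⟨∑ i ∈ Finset.range (N + 1),
    Polynomial.C ((i.factorial : ℂ)⁻¹ * iteratedDeriv i g 0) * Polynomial.X ^ i,
    Polynomial.natDegree_sum_range_C_mul_X_pow_le _ _, fun z => ?_⟩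
  · rw [← Complex.taylorSeries_eq_of_entire' (c := 0) (z := z) hg,
      tsum_eq_sum (s := Finset.range (N + 1))]
    · simp [Polynomial.eval_finsetSum]
    · intro i hi
      rw [hk i (by simpa using hi)]
      simp

/-- A function which is polynomial of bounded degree in each variable separately is polynomial. -/
theorem exists_mvPolynomial_eq_of_separately {N : ℕ} : ∀ {m : ℕ} (g : (Fin m → ℂ) → ℂ),
    (∀ i x, ∃ q : Polynomial ℂ, q.natDegree ≤ N ∧
      ∀ z, g (Function.update x i z) = q.eval z) →
    ∃ p : MvPolynomial (Fin m) ℂ, ∀ x, g x = MvPolynomial.eval x p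
  | 0, g, _ => ⟨MvPolynomial.C (g 0), fun x => by simp [Subsingleton.elim x 0]⟩
  | m + 1, g, h => by
    have hinj : Set.InjOn (fun j : ℕ => (j : ℂ)) (Finset.range (N + 1) : Set ℕ) :=
      Nat.cast_injective.injOn
    have ih : ∀ j : ℕ, ∃ p : MvPolynomial (Fin m) ℂ,
        ∀ y, g (Fin.cons (j : ℂ) y) = MvPolynomial.eval y p := by
      intro j
      refine exists_mvPolynomial_eq_of_separately (N := N) (fun y => g (Fin.cons (j : ℂ) y)) fun i y => ?_
      obtain ⟨q, hq, hqe⟩ := h i.succ (Fin.cons (j : ℂ) y)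
      exact ⟨q, hq, fun z => by rw [Fin.cons_update]; exact hqe z⟩
    choose P hP using ih
    refine ⟨∑ j ∈ Finset.range (N + 1), Polynomial.aeval (MvPolynomial.X 0)
      (Lagrange.basis (Finset.range (N + 1)) (fun j : ℕ => (j : ℂ)) j) *
        MvPolynomial.rename Fin.succ (P j), fun x => ?_⟩
    obtain ⟨q, hq, hqe⟩ := h 0 x
    have hu : ∀ z, g (Fin.cons z (Fin.tail x)) = q.eval z := fun z => by
      rw [← hqe z]
      congr 1
      conv_rhs => rw [← Fin.cons_self_tail x, Fin.update_cons_zero]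
    have hx : g x = q.eval (x 0) := by rw [← hu, Fin.cons_self_tail]
    rw [hx, Lagrange.eq_interpolate hinj (f := q) 
      (Polynomial.degree_lt_card_range_of_natDegree_le hq), Lagrange.interpolate_apply,
      Polynomial.eval_finsetSum, map_sum]
    refine Finset.sum_congr rfl fun j _ => ?_
    rw [Polynomial.eval_mul, Polynomial.eval_C, ← hu, hP, map_mul, MvPolynomial.eval_rename,
      mul_comm]
    congr 1
    rw [← MvPolynomial.coe_aeval_eq_eval, RingHom.coe_coe, ← Polynomial.aeval_algHom_apply]
    simp

/-- A rotation relation kills every Taylor coefficient at which its symbol does not vanish. -/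
theorem iteratedDeriv_mul_eq_zero_of_rotation_relation {φ : ℂ → ℂ} {r : ℝ} (hr : 0 < r)
    (hφ : DifferentiableOn ℂ φ (Metric.ball 0 r)) {ω : ℂ} (hω : ‖ω‖ = 1) {Q : Polynomial ℂ}
    (h : ∀ z ∈ Metric.ball (0 : ℂ) r, ∑ j ∈ Q.support, Q.coeff j * φ (ω ^ j * z) = 0) (k : ℕ) :
    Q.eval (ω ^ k) * iteratedDeriv k φ 0 = 0 := by
  set a : ℕ → ℂ := fun k => (k.factorial : ℂ)⁻¹ * (Q.eval (ω ^ k) * iteratedDeriv k φ 0) with ha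
  have hs : HasFPowerSeriesAt (fun _ : ℂ => (0 : ℂ)) (FormalMultilinearSeries.ofScalars ℂ a) 0 := by
    rw [hasFPowerSeriesAt_iff]
    filter_upwards [Metric.ball_mem_nhds (0 : ℂ) hr] with z hz
    rw [← h z hz]
    have : ∀ j ∈ Q.support, HasSum (fun k : ℕ => Q.coeff j *
        ((k.factorial : ℂ)⁻¹ • (ω ^ j * z - 0) ^ k • iteratedDeriv k φ 0))
        (Q.coeff j * φ (ω ^ j * z)) := fun j _ =>
      (Complex.hasSum_taylorSeries_on_ball hφ (by simpa [hω] using hz)).mul_left _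
    convert! hasSum_sum this using 2 with k
    rw [FormalMultilinearSeries.coeff_ofScalars, ha]
    simp only [Polynomial.eval_eq_sum, Polynomial.sum, smul_eq_mul, Finset.sum_mul,
      Finset.mul_sum, sub_zero]
    refine Finset.sum_congr rfl fun j _ => ?_
    rw [mul_pow, ← pow_mul, ← pow_mul, mul_comm j k]
    ring
  have h0 : a k = 0 := by
    rw [← FormalMultilinearSeries.coeff_ofScalars (𝕜 := ℂ) (p := a), hs.eq_zero]
    rfl
  exact (mul_eq_zero.mp h0).resolve_left
    (inv_ne_zero (Nat.cast_ne_zero.mpr (Nat.factorial_ne_zero k)))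

section
variable {E : Type*} [NormedAddCommGroup E] [NormedSpace ℂ E] {F : E → ℂ}

theorem exists_polynomial_on_lines_of_rotation_relation
    (hF : DifferentiableOn ℂ F (Metric.ball 0 1)) {ω : ℂ} (hω : ‖ω‖ = 1)
    (hinj : Function.Injective fun k : ℕ => ω ^ k) {Q : Polynomial ℂ} (hQ : Q ≠ 0)
    (h : ∀ w ∈ Metric.ball (0 : E) 1, ∑ j ∈ Q.support, Q.coeff j * F (ω ^ j • w) = 0) :
    ∃ N : ℕ, ∀ w : E, ∃ q : Polynomial ℂ, q.natDegree ≤ N ∧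
      ∀ z : ℂ, ‖z • w‖ < 1 → F (z • w) = q.eval z := by
  have hfin : {k : ℕ | Q.eval (ω ^ k) = 0}.Finite := by
    refine Set.Finite.preimage (f := fun k : ℕ => ω ^ k) (s := {x | Q.eval x = 0})
      hinj.injOn ?_
    exact Q.finite_setOfPred_isRoot hQ
  obtain ⟨N, hN⟩ := hfin.bddAbove
  refine ⟨N, fun w => ⟨∑ i ∈ Finset.range (N + 1), Polynomial.C ((i.factorial : ℂ)⁻¹ *
    iteratedDeriv i (fun z : ℂ => F (z • w)) 0) * Polynomial.X ^ i,
    Polynomial.natDegree_sum_range_C_mul_X_pow_le _ _, fun z hz => ?_⟩⟩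
  obtain ⟨r, hzr, hr⟩ : ∃ r : ℝ, ‖z‖ < r ∧ r * ‖w‖ ≤ 1 := by
    rcases eq_or_ne w 0 with rfl | hw
    · exact ⟨‖z‖ + 1, by simp, by simp⟩
    · have : 0 < ‖w‖ := norm_pos_iff.mpr hw
      refine ⟨1 / ‖w‖, ?_, by field_simp; rfl⟩
      rwa [lt_div_iff₀ this, ← norm_smul]
  have hr0 : 0 < r := (norm_nonneg z).trans_lt hzr
  have hmaps : ∀ z ∈ Metric.ball (0 : ℂ) r, z • w ∈ Metric.ball (0 : E) 1 := by
    intro z hz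
    rw [mem_ball_zero_iff] at hz ⊢
    rw [norm_smul]
    rcases eq_or_ne w 0 with rfl | hw
    · simp
    · exact (mul_lt_mul_of_pos_right hz (norm_pos_iff.mpr hw)).trans_le hr
  have hφ : DifferentiableOn ℂ (fun z : ℂ => F (z • w)) (Metric.ball 0 r) :=
    hF.comp (by fun_prop) hmaps
  have hzero : ∀ k, N < k → iteratedDeriv k (fun z : ℂ => F (z • w)) 0 = 0 := by
    intro k hk
    refine (mul_eq_zero.mp (iteratedDeriv_mul_eq_zero_of_rotation_relation hr0 hφ hω (Q := Q)
      (fun z hz => ?_) k)).resolve_left fun h0 => hk.not_ge (hN h0)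
    simpa only [mul_smul] using h _ (hmaps z hz)
  rw [← Complex.taylorSeries_eq_on_ball' (c := 0) (z := z) (r := r) (by simpa using hzr) hφ,
    tsum_eq_sum (s := Finset.range (N + 1))]
  · simp [Polynomial.eval_finsetSum]
  · intro i hi
    rw [hzero i (by simpa using hi)]
    simp

theorem exists_entire_extension_of_polynomial_on_lines [ProperSpace E]
    (hF : DifferentiableOn ℂ F (Metric.ball 0 1)) {N : ℕ}
    (h : ∀ w : E, ∃ q : Polynomial ℂ, q.natDegree ≤ N ∧
      ∀ z : ℂ, ‖z • w‖ < 1 → F (z • w) = q.eval z) :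
    ∃ G : E → ℂ, Differentiable ℂ G ∧ Set.EqOn G F (Metric.ball 0 1) ∧
      ∃ C, ∀ w, ‖G w‖ ≤ C * (1 + ‖w‖) ^ N := by
  choose q hqN hq using h
  set s := Finset.range (N + 1)
  set t : ℕ → ℂ := fun j => (j : ℂ) / (2 * (N + 1)) with ht
  have hN0 : (2 * (N + 1) : ℂ) ≠ 0 := by exact_mod_cast (by positivity : 2 * (N + 1) ≠ 0)
  have htinj : Set.InjOn t s := fun i _ j _ hij => by
    simpa [ht, div_left_inj' hN0] using hij
  have htn : ∀ j ∈ s, ‖t j‖ ≤ 1 / 2 := by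
    intro j hj
    have hj' : (j : ℝ) ≤ N := by exact_mod_cast Nat.lt_succ_iff.mp (Finset.mem_range.mp hj)
    have : ‖(2 * (N + 1) : ℂ)‖ = 2 * (N + 1) := by
      rw [← Nat.cast_succ, norm_mul, Complex.norm_natCast]; simp
    rw [ht]
    simp only
    rw [norm_div, this, Complex.norm_natCast, div_le_div_iff₀ (by positivity) (by norm_num)]
    linarith
  set L : ℕ → Polynomial ℂ := Lagrange.basis s t with hL
  have hmem : ∀ R : ℝ, 0 < R → ∀ w : E, ‖w‖ < R → ∀ j ∈ s,
      ‖(t j / (R : ℂ)) • w‖ ≤ 1 / 2 := by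
    intro R hR w hw j hj
    rw [norm_smul, norm_div, Complex.norm_of_nonneg hR.le]
    have := htn j hj
    calc ‖t j‖ / R * ‖w‖ ≤ (1 / 2) / R * R := by gcongr
      _ = _ := by field_simp
  have key : ∀ R : ℝ, 0 < R → ∀ w : E, ‖w‖ < R →
      (q w).eval 1 = ∑ j ∈ s, (L j).eval (R : ℂ) * F ((t j / (R : ℂ)) • w) := by
    intro R hR w hw
    have hR' : (R : ℂ) ≠ 0 := by exact_mod_cast hR.ne'
    set p := (q w).comp (Polynomial.C (R : ℂ)⁻¹ * Polynomial.X) with hp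
    have hpd : p.degree < s.card := by
      refine Polynomial.degree_lt_card_range_of_natDegree_le (Polynomial.natDegree_comp_le.trans ?_)
      calc _ ≤ N * 1 := Nat.mul_le_mul (hqN w) ((Polynomial.natDegree_C_mul_le _ _).trans Polynomial.natDegree_X_le)
        _ = N := mul_one N
    have h1 : (q w).eval 1 = p.eval (R : ℂ) := by simp [hp, hR']
    rw [h1, Lagrange.eq_interpolate htinj hpd, Lagrange.interpolate_apply,
      Polynomial.eval_finsetSum]
    refine Finset.sum_congr rfl fun j hj => ?_
    rw [Polynomial.eval_mul, Polynomial.eval_C, hq w _ ((hmem R hR w hw j hj).trans_lt (by norm_num)),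
      mul_comm]
    simp [hp, hL, div_eq_inv_mul]
  refine ⟨fun w => (q w).eval 1, fun w => ?_, fun w hw => ?_, ?_⟩
  · have hR : 0 < ‖w‖ + 1 := by positivity
    have hd : DifferentiableAt ℂ (fun v => ∑ j ∈ s, (L j).eval ((‖w‖ + 1 : ℝ) : ℂ) *
        F ((t j / ((‖w‖ + 1 : ℝ) : ℂ)) • v)) w := by
      refine DifferentiableAt.fun_sum fun j hj => DifferentiableAt.const_mul ?_ _
      have hFj : DifferentiableAt ℂ F ((t j / ((‖w‖ + 1 : ℝ) : ℂ)) • w) :=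
        hF.differentiableAt (Metric.isOpen_ball.mem_nhds (mem_ball_zero_iff.mpr
          ((hmem _ hR w (lt_add_one _) j hj).trans_lt (by norm_num))))
      exact hFj.comp w (f := fun v : E => (t j / ((‖w‖ + 1 : ℝ) : ℂ)) • v) (by fun_prop)
    refine hd.congr_of_eventuallyEq ?_
    filter_upwards [Metric.isOpen_ball.mem_nhds (mem_ball_zero_iff.mpr (lt_add_one ‖w‖))] with v hv
    exact key _ hR v (mem_ball_zero_iff.mp hv)
  · have := hq w 1 (by simpa using hw)
    simpa using this.symm
  · obtain ⟨M, hM⟩ := (isCompact_closedBall (0 : E) (1 / 2)).exists_bound_of_continuousOn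
      (hF.continuousOn.mono (Metric.closedBall_subset_ball (by norm_num)))
    have hM0 : 0 ≤ M := (norm_nonneg _).trans (hM 0 (by simp))
    have hLN : ∀ j ∈ s, (L j).natDegree ≤ N := fun j hj => by
      rw [hL, Lagrange.natDegree_basis htinj hj]; simp [s]
    have hb : ∀ j, ∃ C, 0 ≤ C ∧ (j ∈ s → ∀ z, ‖(L j).eval z‖ ≤ C * (1 + ‖z‖) ^ N) := by
      intro j
      by_cases hj : j ∈ s
      · obtain ⟨C, hC, h⟩ := (L j).exists_norm_eval_le (hLN j hj)
        exact ⟨C, hC, fun _ => h⟩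
      · exact ⟨0, le_rfl, fun h => absurd h hj⟩
    choose C hC0 hC using hb
    refine ⟨∑ j ∈ s, C j * 2 ^ N * M, fun w => ?_⟩
    have hw : ‖w‖ < 1 + ‖w‖ := by linarith
    have hR : 0 < 1 + ‖w‖ := by positivity
    simp only
    rw [key _ hR w hw, Finset.sum_mul]
    refine (norm_sum_le _ _).trans (Finset.sum_le_sum fun j hj => ?_)
    rw [norm_mul]
    have h1 := hC j hj ((1 + ‖w‖ : ℝ) : ℂ)
    rw [Complex.norm_of_nonneg hR.le] at h1
    have h2 := hM _ (mem_closedBall_zero_iff.mpr (hmem _ hR w hw j hj))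
    have h3 : (1 + (1 + ‖w‖)) ^ N ≤ 2 ^ N * (1 + ‖w‖) ^ N := by
      rw [← mul_pow]
      gcongr
      linarith [norm_nonneg w]
    calc _ ≤ (C j * (2 ^ N * (1 + ‖w‖) ^ N)) * M := by
          have h4 := h1.trans (mul_le_mul_of_nonneg_left h3 (hC0 j))
          exact mul_le_mul h4 h2 (norm_nonneg _) ((norm_nonneg _).trans h4)
      _ = _ := by ring

end

theorem exists_mvPolynomial_eq_of_norm_le_pow {m : ℕ} {G : EuclideanSpace ℂ (Fin m) → ℂ}
    (hG : Differentiable ℂ G) {C : ℝ} {N : ℕ} (hC : ∀ w, ‖G w‖ ≤ C * (1 + ‖w‖) ^ N) :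
    ∃ p : MvPolynomial (Fin m) ℂ, ∀ w, G w = MvPolynomial.eval (fun i => w i) p := by
  have hC0 : 0 ≤ C := by simpa using (norm_nonneg _).trans (hC 0)
  obtain ⟨p, hp⟩ := exists_mvPolynomial_eq_of_separately (N := N)
    (fun x : Fin m → ℂ => G (WithLp.toLp 2 x)) fun i x => by
      have hu : ∀ z, WithLp.toLp 2 (Function.update x i z) =
          WithLp.toLp 2 (Function.update x i 0) + z • EuclideanSpace.single i (1 : ℂ) := by
        intro z
        ext k
        by_cases hk : k = i
        · subst hk; simp
        · simp [hk]
      set a := WithLp.toLp 2 (Function.update x i 0) with ha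
      refine exists_polynomial_eq_of_norm_le_pow (C := C * (1 + ‖a‖) ^ N) (N := N) ?_ fun z => ?_
      · simp only [hu]
        exact hG.comp (by fun_prop)
      · simp only [hu]
        refine (hC _).trans ?_
        rw [mul_assoc, ← mul_pow]
        gcongr
        have := norm_add_le a (z • EuclideanSpace.single i (1 : ℂ))
        rw [norm_smul, PiLp.norm_single, norm_one, mul_one] at this
        nlinarith [norm_nonneg a, norm_nonneg z]
  exact ⟨p, fun w => hp w.ofLp⟩

theorem exp_I_pow_injective : Function.Injective fun k : ℕ => Complex.exp Complex.I ^ k := by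
  intro k l h
  simp only [← Complex.exp_nat_mul] at h
  obtain ⟨n, hn⟩ := Complex.exp_eq_exp_iff_exists_int.mp h
  have h1 : (k : ℝ) = l + n * (2 * Real.pi) := by
    have := congrArg Complex.im hn
    simpa using this
  by_cases hn0 : n = 0
  · subst hn0
    simpa using h1
  · exfalso
    refine irrational_pi ⟨((k : ℚ) - l) / (2 * n), ?_⟩
    have : (n : ℝ) ≠ 0 := by exact_mod_cast hn0
    push_cast
    rw [h1]
    field_simp
    ring

/-- a holomorphic function on the unit ball is a finite vector of
the rotation action of the circle group iff it is (the restriction of) a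
polynomial. -/
theorem stmt_13 (n : ℕ) (f : ↥(ballB n) → ℂ) (hf : HoloOnB n f) :
    FiniteDimensional ℂ
        ↥(Submodule.span ℂ {g : ↥(ballB n) → ℂ |
            ∃ (α : ℂ) (hα : ‖α‖ = 1), g = fun w => f (rotB n α hα w)}) ↔
      ∃ p : MvPolynomial (Fin (n + 1)) ℂ,
        ∀ w : ↥(ballB n),
          f w = MvPolynomial.eval (fun i => (w : EuclideanSpace ℂ (Fin (n + 1))) i) p := by
  constructor
  · intro hfd
    obtain ⟨F, hF, hFf⟩ := hf
    set V := Submodule.span ℂ {g : ↥(ballB n) → ℂ |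
      ∃ (α : ℂ) (hα : ‖α‖ = 1), g = fun w => f (rotB n α hα w)} with hV
    have hω : ‖Complex.exp Complex.I‖ = 1 := by simpa using Complex.norm_exp_ofReal_mul_I 1
    have hωj : ∀ j : ℕ, ‖Complex.exp Complex.I ^ j‖ = 1 := fun j => by rw [norm_pow, hω, one_pow]
    let v : ℕ → V := fun j => ⟨fun w => f (rotB n _ (hωj j) w),
      Submodule.subset_span ⟨_, hωj j, rfl⟩⟩
    have hli : ¬ LinearIndependent ℂ v := fun hli => by
      have := hli.finite
      exact not_finite ℕ
    obtain ⟨s, g, hsum, i, his, hgi⟩ := not_linearIndependent_iff.mp hli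
    set Q : Polynomial ℂ := ∑ j ∈ s, Polynomial.monomial j (g j) with hQ
    have hcoeff : ∀ j, Q.coeff j = if j ∈ s then g j else 0 := fun j => by
      simp [hQ, Polynomial.coeff_monomial]
    have hQ0 : Q ≠ 0 := fun h => hgi (by simpa [h, his] using (hcoeff i).symm)
    have hrel : ∀ w ∈ Metric.ball (0 : EuclideanSpace ℂ (Fin (n + 1))) 1,
        ∑ j ∈ Q.support, Q.coeff j * F (Complex.exp Complex.I ^ j • w) = 0 := by
      intro w hw
      have h : ∑ j ∈ s, g j * F (Complex.exp Complex.I ^ j • w) = 0 := by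
        simpa [v, ← hFf, rotB] using congrFun (congrArg Subtype.val hsum) ⟨w, hw⟩
      rw [← h, Finset.sum_subset (s₂ := s)]
      · exact Finset.sum_congr rfl fun j hj => by rw [hcoeff, if_pos hj]
      · intro j hj
        by_contra hjs
        exact Polynomial.mem_support_iff.mp hj (by rw [hcoeff, if_neg hjs])
      · intro j _ hj
        rw [Polynomial.notMem_support_iff.mp hj, zero_mul]
    obtain ⟨N, hN⟩ :=
      exists_polynomial_on_lines_of_rotation_relation hF hω exp_I_pow_injective hQ0 hrel
    obtain ⟨G, hG, hGF, C, hC⟩ := exists_entire_extension_of_polynomial_on_lines hF hN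
    obtain ⟨p, hp⟩ := exists_mvPolynomial_eq_of_norm_le_pow hG hC
    exact ⟨p, fun w => by rw [← hFf w, ← hGF w.2, hp]⟩
  · rintro ⟨p, hp⟩
    let mon : (Fin (n + 1) →₀ ℕ) → ↥(ballB n) → ℂ := fun d w =>
      ∏ i, (w : EuclideanSpace ℂ (Fin (n + 1))) i ^ d i
    have : FiniteDimensional ℂ (Submodule.span ℂ (mon '' (p.support : Set (Fin (n + 1) →₀ ℕ)))) :=
      FiniteDimensional.span_of_finite ℂ (p.support.finite_toSet.image mon)
    refine Submodule.finiteDimensional_of_le (Submodule.span_le.mpr ?_)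
      (S₂ := Submodule.span ℂ (mon '' (p.support : Set (Fin (n + 1) →₀ ℕ))))
    rintro _ ⟨α, hα, rfl⟩
    have : (fun w => f (rotB n α hα w)) =
        ∑ d ∈ p.support, (p.coeff d * ∏ i, α ^ d i) • mon d := by
      funext w
      rw [hp, MvPolynomial.eval_eq', Finset.sum_apply]
      refine Finset.sum_congr rfl fun d _ => ?_
      simp [rotB, mon, mul_pow, Finset.prod_mul_distrib, mul_assoc]
    rw [this]
    exact Submodule.sum_mem _ fun d hd => Submodule.smul_mem _ _
      (Submodule.subset_span ⟨d, hd, rfl⟩)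
end
end
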